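/- Let d be a positive integer such that d·(2^l + 1) ≡ 2^i (mod 2^n − 1) for some nonnegative integer i. If k = 1 (equivalently gcd(l, n) = 1), then the set of values {C_d(τ) : 0 ≤ τ ≤ 2^n − 2} is exactly the three-element set {−1, −1 + 2^n, −1 − 2^{n+1}}; if k ≥ 2 (equivalently gcd(l, n) > 1), then this value set is exactly the four-element set {−1, −1 + 2^n, −1 − 2^n, −1 − 2^{n+k}}. -/

import Mathlib

open Finset

-- For `v` in the prime subfield `{0,1}` of `F`, `sgnF v` is the integer `(−1)^v`:
-- `1` if `v = 0` and `−1` if `v = 1`.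
open Classical in
noncomputable def sgnF {F : Type*} [Zero F] (v : F) : ℤ :=
  if v = 0 then 1 else -1

-- `trF j x = Σ_{i=0}^{j−1} x^(2^i)`.
def trF {F : Type*} [Field F] (j : ℕ) (x : F) : F :=
  ∑ i ∈ Finset.range j, x ^ 2 ^ i

-- The cross correlation `C_d(τ) = Σ_{t=0}^{2^m−2} (−1)^{s_t + u_{d(t+τ)}}` between the
-- `m`-sequence `s_t = tr_m(α^t)` of period `2^m−1` and the `d`-decimation of the
-- `m`-sequence `u_t = tr_n(β^t)` of period `2^n−1`, where `β = α^(2^n+1)`.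
noncomputable def crossCorr {F : Type*} [Field F] (m n d : ℕ) (α : F) (τ : ℕ) : ℤ :=
  ∑ t ∈ Finset.range (2 ^ m - 1),
    sgnF (trF m (α ^ t) + trF n ((α ^ (2 ^ n + 1)) ^ (d * (t + τ))))

section Trace

variable {F : Type*} [Field F]

theorem trF_add [CharP F 2] (n : ℕ) (x y : F) : trF n (x + y) = trF n x + trF n y := by
  simp only [trF, add_pow_char_pow, sum_add_distrib]

theorem trF_zero (n : ℕ) : trF n (0 : F) = 0 := by
  simp [trF]

theorem trF_sq [CharP F 2] (n : ℕ) (x : F) : trF n x ^ 2 = trF n (x ^ 2) := by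
  simp only [trF, sum_pow_char, ← pow_mul, mul_comm]

theorem trF_sq_of_fixed {n : ℕ} {x : F} (hx : x ^ 2 ^ n = x) : trF n (x ^ 2) = trF n x := by
  have h1 := sum_range_succ (fun i => x ^ 2 ^ i) n
  rw [sum_range_succ', hx] at h1
  simp only [pow_zero, pow_one, add_left_inj] at h1
  simpa only [trF, ← pow_mul, ← pow_succ'] using h1

theorem pow_two_pow_fixed {n : ℕ} {x : F} (hx : x ^ 2 ^ n = x) (a : ℕ) :
    (x ^ a) ^ 2 ^ n = x ^ a := by
  rw [← pow_mul, mul_comm, pow_mul, hx]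

theorem trF_pow_two_pow [CharP F 2] {n : ℕ} {x : F} (hx : x ^ 2 ^ n = x) (j : ℕ) :
    trF n (x ^ 2 ^ j) = trF n x := by
  induction j with
  | zero => simp
  | succ j ih => rw [pow_succ, pow_mul, trF_sq_of_fixed (pow_two_pow_fixed hx _), ih]

theorem trF_eq_zero_or_one [CharP F 2] {n : ℕ} {x : F} (hx : x ^ 2 ^ n = x) :
    trF n x = 0 ∨ trF n x = 1 := by
  have h : trF n x ^ 2 = trF n x := (trF_sq n x).trans (trF_sq_of_fixed hx)
  have : trF n x * (trF n x - 1) = 0 := by linear_combination h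
  rcases mul_eq_zero.1 this with h | h
  · exact Or.inl h
  · exact Or.inr (sub_eq_zero.1 h)

theorem trF_two_mul [CharP F 2] (n : ℕ) (x : F) : trF (2 * n) x = trF n (x + x ^ 2 ^ n) := by
  rw [trF_add, two_mul]
  simp only [trF, sum_range_add, ← pow_mul, ← pow_add]

theorem sgnF_trF_add [CharP F 2] {n : ℕ} {x y : F} (hx : x ^ 2 ^ n = x) (hy : y ^ 2 ^ n = y) :
    sgnF (trF n (x + y)) = sgnF (trF n x) * sgnF (trF n y) := by
  rw [trF_add]
  rcases trF_eq_zero_or_one hx with h | h <;> rcases trF_eq_zero_or_one hy with h' | h' <;>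
    simp [h, h', sgnF, CharTwo.add_self_eq_zero]

theorem fixed_add [CharP F 2] {n : ℕ} {x y : F} (hx : x ^ 2 ^ n = x) (hy : y ^ 2 ^ n = y) :
    (x + y) ^ 2 ^ n = x + y := by
  rw [add_pow_char_pow, hx, hy]

theorem fixed_mul {n : ℕ} {x y : F} (hx : x ^ 2 ^ n = x) (hy : y ^ 2 ^ n = y) :
    (x * y) ^ 2 ^ n = x * y := by
  rw [mul_pow, hx, hy]

theorem fixed_inv {n : ℕ} {x : F} (hx : x ^ 2 ^ n = x) : x⁻¹ ^ 2 ^ n = x⁻¹ := by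
  rw [inv_pow, hx]

theorem pow_two_pow_inj [CharP F 2] (j : ℕ) {x y : F} (h : x ^ 2 ^ j = y ^ 2 ^ j) : x = y :=
  iterateFrobenius_inj F 2 j (by simpa only [iterateFrobenius_def] using h)

theorem fixed_gcd [CharP F 2] {a b : ℕ} {x : F} (ha : x ^ 2 ^ a = x) (hb : x ^ 2 ^ b = x) :
    x ^ 2 ^ Nat.gcd a b = x := by
  have key : ∀ j, Function.IsPeriodicPt (frobenius F 2) j x ↔ x ^ 2 ^ j = x := fun j => by
    rw [Function.IsPeriodicPt, Function.IsFixedPt, iterate_frobenius]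
  exact (key _).1 (((key a).2 ha).gcd ((key b).2 hb))

theorem fixed_of_dvd [CharP F 2] {a b : ℕ} (hab : a ∣ b) {x : F} (ha : x ^ 2 ^ a = x) : x ^ 2 ^ b = x := by
  have key : ∀ j, Function.IsPeriodicPt (frobenius F 2) j x ↔ x ^ 2 ^ j = x := fun j => by
    rw [Function.IsPeriodicPt, Function.IsFixedPt, iterate_frobenius]
  exact (key _).1 (((key a).2 ha).trans_dvd hab)

theorem fixed_iff {n : ℕ} {x : F} : x ^ 2 ^ n = x ↔ x = 0 ∨ x ^ (2 ^ n - 1) = 1 := by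
  obtain ⟨p, hp⟩ : ∃ p, 2 ^ n = p + 1 := ⟨2 ^ n - 1, by have := Nat.one_le_two_pow (n := n); omega⟩
  rw [hp, Nat.add_sub_cancel, pow_succ]
  constructor
  · intro h
    by_cases hx : x = 0
    · exact Or.inl hx
    · exact Or.inr (mul_right_cancel₀ hx (by rw [h, one_mul]))
  · rintro (h | h)
    · simp [h]
    · rw [h, one_mul]

end Trace

/-- The elements of the subfield of order `2 ^ n`, when `F` has one. -/
def fixedSet (F : Type*) [Field F] [Fintype F] [DecidableEq F] (n : ℕ) : Finset F :=
  univ.filter fun x => x ^ 2 ^ n = x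

/-- The nonzero elements of `fixedSet F n`. -/
def fixedUnits (F : Type*) [Field F] [Fintype F] [DecidableEq F] (n : ℕ) : Finset F :=
  (fixedSet F n).erase 0

/-- The `N`-th roots of unity. -/
def unityRoots (F : Type*) [Field F] [Fintype F] [DecidableEq F] (N : ℕ) : Finset F :=
  univ.filter fun x => x ^ N = 1

section Cardinality

variable {F : Type*} [Field F] [Fintype F]

theorem isPrimitiveRoot_of_generates {M : ℕ} (hF : Fintype.card F = M + 1) {α : F} (hα0 : α ≠ 0)
    (hα : ∀ x : F, x ≠ 0 → ∃ j : ℕ, α ^ j = x) : IsPrimitiveRoot α M := by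
  have h : orderOf (Units.mk0 α hα0) = M := by
    rw [orderOf_eq_card_of_forall_mem_zpowers, Nat.card_units, Nat.card_eq_fintype_card, hF,
      Nat.add_sub_cancel]
    intro x
    obtain ⟨j, hj⟩ := hα x x.ne_zero
    exact ⟨j, Units.ext (by simpa using hj)⟩
  have := IsPrimitiveRoot.orderOf α
  rwa [← Units.val_mk0 hα0, orderOf_units, h] at this

variable [DecidableEq F]

theorem mem_fixedSet {n : ℕ} {x : F} : x ∈ fixedSet F n ↔ x ^ 2 ^ n = x := by
  simp [fixedSet]

theorem mem_fixedUnits {n : ℕ} {x : F} : x ∈ fixedUnits F n ↔ x ≠ 0 ∧ x ^ 2 ^ n = x := by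
  simp [fixedUnits, mem_fixedSet]

theorem mem_unityRoots {N : ℕ} {x : F} : x ∈ unityRoots F N ↔ x ^ N = 1 := by
  simp [unityRoots]

theorem card_unityRoots {M N : ℕ} (hM : 0 < M) {α : F} (hα : IsPrimitiveRoot α M) (hN : N ∣ M) :
    #(unityRoots F N) = N := by
  obtain ⟨c, rfl⟩ := hN
  have hN0 : 0 < N := Nat.pos_of_mul_pos_right hM
  have h := (hα.pow hM (mul_comm N c)).card_nthRootsFinset
  convert h
  ext x
  rw [mem_unityRoots, Polynomial.mem_nthRootsFinset hN0]

theorem fixedUnits_eq [CharP F 2] {n : ℕ} (hn : n ≠ 0) :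
    fixedUnits F n = unityRoots F (2 ^ n - 1) := by
  have : 2 ^ n - 1 ≠ 0 := by have := Nat.one_lt_two_pow hn; omega
  ext x
  rw [mem_fixedUnits, mem_unityRoots, fixed_iff]
  constructor
  · rintro ⟨h0, h | h⟩
    · exact absurd h h0
    · exact h
  · intro h
    refine ⟨?_, Or.inr h⟩
    rintro rfl
    simp [zero_pow this] at h

theorem card_fixedUnits [CharP F 2] {m n : ℕ} (hm : m ≠ 0) (hn : n ≠ 0) (hnm : n ∣ m) {α : F}
    (hα : IsPrimitiveRoot α (2 ^ m - 1)) : #(fixedUnits F n) = 2 ^ n - 1 := by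
  rw [fixedUnits_eq hn]
  refine card_unityRoots ?_ hα ?_
  · have := Nat.one_lt_two_pow hm; omega
  · obtain ⟨c, rfl⟩ := hnm
    rw [pow_mul]
    simpa using Nat.sub_dvd_pow_sub_pow (2 ^ n) 1 c

theorem zero_mem_fixedSet {n : ℕ} : (0 : F) ∈ fixedSet F n := by
  rw [mem_fixedSet]; exact zero_pow (by positivity)

theorem card_fixedSet [CharP F 2] {m n : ℕ} (hm : m ≠ 0) (hn : n ≠ 0) (hnm : n ∣ m) {α : F}
    (hα : IsPrimitiveRoot α (2 ^ m - 1)) : #(fixedSet F n) = 2 ^ n := by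
  have h := card_fixedUnits hm hn hnm hα
  rw [fixedUnits, card_erase_of_mem zero_mem_fixedSet] at h
  have := Nat.one_lt_two_pow hn
  omega

theorem sum_comp_of_injOn {ι M : Type*} [AddCommMonoid M] (s : Finset ι) (f : ι → ι)
    (hf : ∀ x ∈ s, f x ∈ s) (hinj : Set.InjOn f s) (g : ι → M) :
    ∑ x ∈ s, g (f x) = ∑ x ∈ s, g x :=
  sum_nbij f hf hinj (surjOn_of_injOn_of_card_le f hf hinj le_rfl) fun _ _ => rfl

end Cardinality

section CharacterSum

/-- The additive character `x ↦ (-1) ^ trF n x`. -/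
noncomputable def trSign {F : Type*} [Field F] (n : ℕ) (x : F) : ℤ := sgnF (trF n x)

variable {F : Type*} [Field F]

theorem trSign_zero (n : ℕ) : trSign n (0 : F) = 1 := by
  simp [trSign, trF_zero, sgnF]

theorem trSign_pow_two_pow [CharP F 2] {n : ℕ} {x : F} (hx : x ^ 2 ^ n = x) (j : ℕ) :
    trSign n (x ^ 2 ^ j) = trSign n x := by
  rw [trSign, trF_pow_two_pow hx, trSign]

theorem trSign_add [CharP F 2] {n : ℕ} {x y : F} (hx : x ^ 2 ^ n = x) (hy : y ^ 2 ^ n = y) :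
    trSign n (x + y) = trSign n x * trSign n y :=
  sgnF_trF_add hx hy

theorem eq_or_eq_inv_of_add_inv_eq {v w : F} (hv : v ≠ 0) (hw : w ≠ 0)
    (h : v + v⁻¹ = w + w⁻¹) : v = w ∨ v = w⁻¹ := by
  field_simp at h
  have : (v - w) * (v * w - 1) = 0 := by linear_combination h
  rcases mul_eq_zero.1 this with h | h
  · exact Or.inl (sub_eq_zero.1 h)
  · exact Or.inr (eq_inv_of_mul_eq_one_left (sub_eq_zero.1 h))

variable [Fintype F] [DecidableEq F]

theorem exists_trSign_eq_neg_one {n : ℕ} (hn : n ≠ 0) (hK : #(fixedSet F n) = 2 ^ n) :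
    ∃ c ∈ fixedSet F n, trSign n c = -1 := by
  by_contra! hcon
  obtain ⟨p, rfl⟩ := Nat.exists_eq_succ_of_ne_zero hn
  have h0 : ∀ x ∈ fixedSet F (p + 1), trF (p + 1) x = 0 := fun x hx => by
    by_contra hx0
    exact hcon x hx (by rw [trSign, sgnF, if_neg hx0])
  let P : Polynomial F := ∑ i ∈ range p, Polynomial.X ^ 2 ^ i
  have hP : P.degree < (2 ^ p : ℕ) := by
    refine (Polynomial.degree_sum_le _ _).trans_lt ?_
    rw [Finset.sup_lt_iff (WithBot.bot_lt_coe _)]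
    intro i hi
    rw [Polynomial.degree_X_pow]
    exact_mod_cast Nat.pow_lt_pow_right one_lt_two (mem_range.1 hi)
  have hmon : (Polynomial.X ^ 2 ^ p + P).Monic := Polynomial.monic_X_pow_add hP
  have hdeg : (Polynomial.X ^ 2 ^ p + P).natDegree = 2 ^ p :=
    Polynomial.natDegree_eq_of_degree_eq_some (by
      rw [Polynomial.degree_add_eq_left_of_degree_lt] <;> rw [Polynomial.degree_X_pow]
      exact hP)
  have hle : #(fixedSet F (p + 1)) ≤ 2 ^ p := by
    rw [← hdeg]
    refine Polynomial.card_le_degree_of_subset_roots fun x hx => ?_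
    rw [Polynomial.mem_roots hmon.ne_zero, Polynomial.IsRoot.def, ← h0 x hx]
    simp [P, trF, Polynomial.eval_finsetSum, sum_range_succ, add_comm]
  rw [hK, pow_succ] at hle
  have := Nat.two_pow_pos p
  omega

theorem pow_eq_inv_of_mem_unityRoots {N : ℕ} {v : F} (hv : v ∈ unityRoots F (N + 1)) :
    v ^ N = v⁻¹ :=
  eq_inv_of_mul_eq_one_left (by rw [← pow_succ]; exact mem_unityRoots.1 hv)

variable [CharP F 2]

theorem sum_trSign_mul {n : ℕ} (hn : n ≠ 0) (hK : #(fixedSet F n) = 2 ^ n) {b : F}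
    (hb : b ^ 2 ^ n = b) (hb0 : b ≠ 0) : ∑ x ∈ fixedSet F n, trSign n (b * x) = 0 := by
  obtain ⟨c, hc, hc1⟩ := exists_trSign_eq_neg_one hn hK
  rw [mem_fixedSet] at hc
  have hcb : (b⁻¹ * c) ^ 2 ^ n = b⁻¹ * c := fixed_mul (fixed_inv hb) hc
  have h := sum_comp_of_injOn (fixedSet F n) (fun x => x + b⁻¹ * c)
    (fun x hx => mem_fixedSet.2 (fixed_add (mem_fixedSet.1 hx) hcb))
    (fun x _ y _ hxy => add_right_cancel hxy) (fun x => trSign n (b * x))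
  have h' : ∑ x ∈ fixedSet F n, trSign n (b * (x + b⁻¹ * c))
      = -∑ x ∈ fixedSet F n, trSign n (b * x) := by
    rw [← sum_neg_distrib]
    refine sum_congr rfl fun x hx => ?_
    rw [mul_add, mul_inv_cancel_left₀ hb0, trSign_add (fixed_mul hb (mem_fixedSet.1 hx)) hc, hc1,
      mul_neg_one]
  exact self_eq_neg.1 (h.symm.trans h')

theorem sum_units_trSign_mul {n : ℕ} (hn : n ≠ 0) (hK : #(fixedSet F n) = 2 ^ n) {b : F}
    (hb : b ^ 2 ^ n = b) :
    ∑ x ∈ fixedUnits F n, trSign n (x * b) = if b = 0 then 2 ^ n - 1 else -1 := by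
  have h := add_sum_erase (fixedSet F n) (fun x => trSign n (x * b)) zero_mem_fixedSet
  simp only [zero_mul, trSign_zero] at h
  rw [fixedUnits]
  split_ifs with hb0
  · subst hb0
    simp only [mul_zero, trSign_zero, sum_const, hK] at h ⊢
    push_cast [nsmul_eq_mul] at h ⊢
    linarith
  · have h' := sum_trSign_mul hn hK hb hb0
    simp only [mul_comm b] at h'
    omega

theorem add_inv_mem_fixedSet_of_mem_unityRoots {n : ℕ} {v : F}
    (hv : v ∈ unityRoots F (2 ^ n + 1)) : v + v⁻¹ ∈ fixedSet F n := by
  rw [mem_fixedSet, add_pow_char_pow, inv_pow, pow_eq_inv_of_mem_unityRoots hv, inv_inv, add_comm]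

theorem add_inv_mem_fixedSet {n : ℕ} {v : F} (hv : v ∈ fixedUnits F n) :
    v + v⁻¹ ∈ fixedSet F n := by
  have := (mem_fixedUnits.1 hv).2
  exact mem_fixedSet.2 (fixed_add this (fixed_inv this))

/-- For `t` in the subfield of order `2 ^ n`, the roots of `v + v⁻¹ = t` lie in the subfield or
on the unit circle, and there are two of them (`v = 1` belonging to both). -/
theorem card_fiber_add_inv {n : ℕ} (hK : #(fixedSet F n) = 2 ^ n)
    (hU : #(unityRoots F (2 ^ n + 1)) = 2 ^ n + 1) {t : F} (ht : t ∈ fixedSet F n) :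
    #{v ∈ unityRoots F (2 ^ n + 1) | v + v⁻¹ = t} + #{v ∈ fixedUnits F n | v + v⁻¹ = t} = 2 := by
  have hU0 : ∀ v ∈ unityRoots F (2 ^ n + 1), v ≠ 0 := by
    rintro v hv rfl
    simp [mem_unityRoots] at hv
  have hUK : ∀ v ∈ unityRoots F (2 ^ n + 1), v ∈ fixedUnits F n → v = 1 := fun v hv hv' => by
    have h1 := pow_eq_inv_of_mem_unityRoots hv
    rw [(mem_fixedUnits.1 hv').2] at h1
    have h2 : v ^ 2 ^ 1 = 1 ^ 2 ^ 1 := by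
      rw [pow_one, one_pow, sq]
      nth_rewrite 1 [h1]
      exact inv_mul_cancel₀ (hU0 v hv)
    exact pow_two_pow_inj 1 h2
  have hle : ∀ t ∈ fixedSet F n, #{v ∈ unityRoots F (2 ^ n + 1) | v + v⁻¹ = t}
      + #{v ∈ fixedUnits F n | v + v⁻¹ = t} ≤ 2 := by
    intro t _
    by_cases ht0 : t = 0
    · have key : ∀ v : F, v ≠ 0 → v + v⁻¹ = t → v = 1 := fun v hv h => by
        rw [ht0, ← CharTwo.add_self_eq_zero (1 : F)] at h
        nth_rewrite 2 [← inv_one] at h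
        rcases eq_or_eq_inv_of_add_inv_eq hv one_ne_zero h with h | h <;> simpa using h
      refine Nat.add_le_add (b := 1) (d := 1) ?_ ?_ <;> rw [card_le_one_iff_subset_singleton] <;>
        refine ⟨1, fun v hv => ?_⟩ <;> rw [mem_filter] at hv <;> rw [mem_singleton]
      · exact key v (hU0 v hv.1) hv.2
      · exact key v (mem_fixedUnits.1 hv.1).1 hv.2
    · rw [← card_union_of_disjoint]
      · rcases (filter (fun v => v + v⁻¹ = t) (unityRoots F (2 ^ n + 1)) ∪
          filter (fun v => v + v⁻¹ = t) (fixedUnits F n)).eq_empty_or_nonempty with h | ⟨w, hw⟩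
        · simp [h]
        · have key : ∀ v ∈ filter (fun v => v + v⁻¹ = t) (unityRoots F (2 ^ n + 1)) ∪
              filter (fun v => v + v⁻¹ = t) (fixedUnits F n), v ≠ 0 ∧ v + v⁻¹ = t := by
            intro v hv
            rcases mem_union.1 hv with hv | hv <;> rw [mem_filter] at hv
            · exact ⟨hU0 v hv.1, hv.2⟩
            · exact ⟨(mem_fixedUnits.1 hv.1).1, hv.2⟩
          refine (card_le_card (t := {w, w⁻¹}) fun v hv => ?_).trans card_le_two
          have h1 := key v hv
          have h2 := key w hw
          simpa using eq_or_eq_inv_of_add_inv_eq h1.1 h2.1 (h1.2.trans h2.2.symm)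
      · rw [disjoint_left]
        intro v hv hv'
        rw [mem_filter] at hv hv'
        have := hUK v hv.1 hv'.1
        rw [this, inv_one, CharTwo.add_self_eq_zero] at hv
        exact ht0 hv.2.symm
  have hcK : #(fixedUnits F n) + 1 = 2 ^ n := by
    rw [fixedUnits, card_erase_add_one zero_mem_fixedSet, hK]
  have hsum : ∑ t ∈ fixedSet F n, (#{v ∈ unityRoots F (2 ^ n + 1) | v + v⁻¹ = t}
      + #{v ∈ fixedUnits F n | v + v⁻¹ = t}) = ∑ t ∈ fixedSet F n, 2 := by
    rw [sum_add_distrib, ← card_eq_sum_card_fiberwise (fun _ => add_inv_mem_fixedSet_of_mem_unityRoots),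
      ← card_eq_sum_card_fiberwise (fun _ => add_inv_mem_fixedSet), sum_const, hK, hU, smul_eq_mul]
    omega
  exact (sum_eq_sum_iff_of_le hle).1 hsum t ht

theorem sum_unitCircle_trSign {n : ℕ} (hn : n ≠ 0) (hK : #(fixedSet F n) = 2 ^ n)
    (hU : #(unityRoots F (2 ^ n + 1)) = 2 ^ n + 1) {e : F} (he : e ∈ fixedUnits F n) :
    ∑ v ∈ unityRoots F (2 ^ n + 1), trSign n (e * (v + v⁻¹))
      = -∑ v ∈ fixedUnits F n, trSign n (e * (v + v⁻¹)) := by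
  rw [eq_neg_iff_add_eq_zero, ← sum_fiberwise_of_maps_to (fun _ => add_inv_mem_fixedSet_of_mem_unityRoots),
    ← sum_fiberwise_of_maps_to (fun _ => add_inv_mem_fixedSet), ← sum_add_distrib]
  calc _ = ∑ t ∈ fixedSet F n, 2 * trSign n (e * t) := by
        refine sum_congr rfl fun t ht => ?_
        have key : ∀ s : Finset F, ∑ v ∈ s with v + v⁻¹ = t, trSign n (e * (v + v⁻¹))
            = #{v ∈ s | v + v⁻¹ = t} * trSign n (e * t) := fun s => by
          rw [← nsmul_eq_mul, ← sum_const]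
          exact sum_congr rfl fun v hv => by rw [(mem_filter.1 hv).2]
        rw [key, key, ← add_mul]
        exact_mod_cast congrArg (fun c : ℕ => (c : ℤ) * trSign n (e * t))
          (card_fiber_add_inv hK hU ht)
    _ = 0 := by
        rw [← mul_sum, sum_trSign_mul hn hK (mem_fixedUnits.1 he).2 (mem_fixedUnits.1 he).1,
          mul_zero]

end CharacterSum

section Correlation

variable {F : Type*} [Field F]

theorem pow_eq_pow_of_modEq_of_fixed {n a b : ℕ} {x : F} (hx0 : x ≠ 0) (hx : x ^ 2 ^ n = x)
    (hab : a ≡ b [MOD 2 ^ n - 1]) : x ^ a = x ^ b :=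
  pow_eq_pow_of_modEq hab ((fixed_iff.1 hx).resolve_left hx0)

variable [Fintype F] [DecidableEq F]

theorem mul_mem_fixedUnits {n : ℕ} {x y : F} (hx : x ∈ fixedUnits F n) (hy : y ∈ fixedUnits F n) :
    x * y ∈ fixedUnits F n := by
  rw [mem_fixedUnits] at *
  exact ⟨mul_ne_zero hx.1 hy.1, fixed_mul hx.2 hy.2⟩

theorem pow_mem_fixedUnits {n : ℕ} {x : F} (hx : x ∈ fixedUnits F n) (a : ℕ) :
    x ^ a ∈ fixedUnits F n := by
  rw [mem_fixedUnits] at *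
  exact ⟨pow_ne_zero _ hx.1, pow_two_pow_fixed hx.2 a⟩

theorem inv_mem_fixedUnits {n : ℕ} {x : F} (hx : x ∈ fixedUnits F n) : x⁻¹ ∈ fixedUnits F n := by
  rw [mem_fixedUnits] at *
  exact ⟨inv_ne_zero hx.1, fixed_inv hx.2⟩

theorem sum_range_pow_primitiveRoot {M : Type*} [AddCommMonoid M] {N : ℕ} {α : F} (hN : 0 < N)
    (hF : Fintype.card F = N + 1) (hα : IsPrimitiveRoot α N) (g : F → M) :
    ∑ t ∈ range N, g (α ^ t) = ∑ x ∈ univ.erase 0, g x := by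
  have hmaps : ∀ t ∈ range N, α ^ t ∈ univ.erase (0 : F) := fun t _ =>
    mem_erase.2 ⟨pow_ne_zero _ (hα.ne_zero hN.ne'), mem_univ _⟩
  have hinj : Set.InjOn (α ^ · : ℕ → F) (range N) := fun a ha b hb h =>
    hα.pow_inj (mem_range.1 ha) (mem_range.1 hb) h
  refine sum_nbij _ hmaps hinj (surjOn_of_injOn_of_card_le _ hmaps hinj ?_) fun _ _ => rfl
  rw [card_erase_of_mem (mem_univ _), card_univ, hF, card_range, Nat.add_sub_cancel]

variable [CharP F 2]

theorem pow_two_pow_add_one_injOn {n l d i : ℕ} (hdi : d * (2 ^ l + 1) ≡ 2 ^ i [MOD 2 ^ n - 1]) :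
    Set.InjOn (fun z : F => z ^ (2 ^ l + 1)) (fixedUnits F n) := by
  intro x hx y hy hxy
  rw [mem_coe, mem_fixedUnits] at hx hy
  refine pow_two_pow_inj i ?_
  rw [← pow_eq_pow_of_modEq_of_fixed hx.1 hx.2 hdi, ← pow_eq_pow_of_modEq_of_fixed hy.1 hy.2 hdi,
    mul_comm, pow_mul, pow_mul]
  exact congrArg (· ^ d) hxy

theorem pow_injOn_of_modEq {n l d i : ℕ} (hdi : d * (2 ^ l + 1) ≡ 2 ^ i [MOD 2 ^ n - 1]) :
    Set.InjOn (fun z : F => z ^ d) (fixedUnits F n) := by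
  intro x hx y hy hxy
  rw [mem_coe, mem_fixedUnits] at hx hy
  refine pow_two_pow_inj i ?_
  rw [← pow_eq_pow_of_modEq_of_fixed hx.1 hx.2 hdi, ← pow_eq_pow_of_modEq_of_fixed hy.1 hy.2 hdi,
    pow_mul, pow_mul]
  exact congrArg (· ^ (2 ^ l + 1)) hxy

theorem sum_trSign_add_inv_eq {n l : ℕ} {z : F} (hz : z ∈ fixedUnits F n) :
    ∑ v ∈ fixedUnits F n, trSign n (z ^ (2 ^ l + 1) * (v + v⁻¹))
      = ∑ x ∈ fixedUnits F n, trSign n (z * (x ^ 2 ^ l + x⁻¹)) := by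
  have hc := mul_mem_fixedUnits hz (inv_mem_fixedUnits (pow_mem_fixedUnits hz (2 ^ l)))
  rw [← sum_comp_of_injOn (fixedUnits F n) (fun x => x ^ 2 ^ (l + 1) * (z * (z ^ 2 ^ l)⁻¹))
    (fun x hx => mul_mem_fixedUnits (pow_mem_fixedUnits hx _) hc)
    (fun x _ y _ hxy => pow_two_pow_inj (l + 1)
      (mul_right_cancel₀ (mem_fixedUnits.1 hc).1 hxy))]
  refine sum_congr rfl fun x hx => ?_
  have hz0 := (mem_fixedUnits.1 hz).1
  have hx0 := (mem_fixedUnits.1 hx).1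
  have h1 : z ^ (2 ^ l + 1) * (x ^ 2 ^ (l + 1) * (z * (z ^ 2 ^ l)⁻¹))
      = (z * x ^ 2 ^ l) ^ 2 ^ 1 := by
    field_simp
    ring
  have h2 : z ^ (2 ^ l + 1) * (x ^ 2 ^ (l + 1) * (z * (z ^ 2 ^ l)⁻¹))⁻¹
      = (z * x⁻¹) ^ 2 ^ (l + 1) := by
    simp only [mul_pow, inv_pow]
    field_simp
    ring
  have hzx := (mem_fixedUnits.1 (mul_mem_fixedUnits hz (pow_mem_fixedUnits hx (2 ^ l)))).2
  have hzx' := (mem_fixedUnits.1 (mul_mem_fixedUnits hz (inv_mem_fixedUnits hx))).2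
  rw [mul_add, mul_add, h1, h2, trSign_add (pow_two_pow_fixed hzx _) (pow_two_pow_fixed hzx' _),
    trSign_add hzx hzx', trSign_pow_two_pow hzx, trSign_pow_two_pow hzx']

theorem sum_polar {M : Type*} [AddCommMonoid M] {n l d i : ℕ}
    (hK : #(fixedSet F n) = 2 ^ n) (hU : #(unityRoots F (2 ^ n + 1)) = 2 ^ n + 1)
    (hF : Fintype.card F = 2 ^ (2 * n)) (hdi : d * (2 ^ l + 1) ≡ 2 ^ i [MOD 2 ^ n - 1])
    (g : F → M) :
    ∑ x ∈ univ.erase 0, g x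
      = ∑ z ∈ fixedUnits F n, ∑ v ∈ unityRoots F (2 ^ n + 1), g (z ^ (2 ^ l + 1) * v) := by
  rw [← sum_product' (f := fun z v => g (z ^ (2 ^ l + 1) * v))]
  symm
  have hmaps : ∀ p ∈ fixedUnits F n ×ˢ unityRoots F (2 ^ n + 1),
      p.1 ^ (2 ^ l + 1) * p.2 ∈ univ.erase (0 : F) := by
    intro p hp
    rw [mem_product, mem_fixedUnits, mem_unityRoots] at hp
    refine mem_erase.2 ⟨mul_ne_zero (pow_ne_zero _ hp.1.1) ?_, mem_univ _⟩
    intro h0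
    simp [h0] at hp
  have hinj : Set.InjOn (fun p : F × F => p.1 ^ (2 ^ l + 1) * p.2)
      (fixedUnits F n ×ˢ unityRoots F (2 ^ n + 1) : Finset (F × F)) := by
    rintro ⟨z, v⟩ hp ⟨w, u⟩ hq h
    rw [mem_coe, mem_product, mem_unityRoots] at hp hq
    dsimp only at hp hq h
    have key : ∀ z v : F, z ∈ fixedUnits F n → v ^ (2 ^ n + 1) = 1 →
        (z ^ (2 ^ l + 1) * v) ^ (2 ^ n + 1) = (z ^ (2 ^ l + 1)) ^ 2 ^ 1 := by
      intro z v hz hv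
      rw [mul_pow, hv, mul_one, pow_succ, pow_two_pow_fixed (mem_fixedUnits.1 hz).2]
      ring
    have h1 := congrArg (· ^ (2 ^ n + 1)) h
    simp only [key _ _ hp.1 hp.2, key _ _ hq.1 hq.2] at h1
    have h2 : z = w := pow_two_pow_add_one_injOn hdi hp.1 hq.1 (pow_two_pow_inj 1 h1)
    subst h2
    rw [mul_right_inj' (pow_ne_zero _ (mem_fixedUnits.1 hp.1).1)] at h
    rw [h]
  refine sum_nbij _ hmaps hinj (surjOn_of_injOn_of_card_le _ hmaps hinj ?_) fun _ _ => rfl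
  rw [card_product, hU, fixedUnits, card_erase_of_mem zero_mem_fixedSet, hK,
    card_erase_of_mem (mem_univ _), card_univ, hF, mul_comm (2 ^ n - 1), mul_comm 2 n, pow_mul]
  simp [← Nat.sq_sub_sq]

theorem crossCorr_eq {n l d i : ℕ} (hn : n ≠ 0) (hF : Fintype.card F = 2 ^ (2 * n))
    (hdi : d * (2 ^ l + 1) ≡ 2 ^ i [MOD 2 ^ n - 1]) {α : F}
    (hα : IsPrimitiveRoot α (2 ^ (2 * n) - 1)) {τ : ℕ} {A : F} (hA : A ∈ fixedUnits F n)
    (hAτ : A ^ 2 ^ (i + 1) = (α ^ (2 ^ n + 1)) ^ (d * τ)) :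
    crossCorr (2 * n) n d α τ
      = -1 + 2 ^ n * (1 - #{x ∈ fixedUnits F n | x ^ 2 ^ l + x⁻¹ = A}) := by
  have h1 : 1 < 2 ^ (2 * n) := Nat.one_lt_two_pow (by omega)
  have hK : #(fixedSet F n) = 2 ^ n := card_fixedSet (by omega) hn (Dvd.intro_left 2 rfl) hα
  have hU : #(unityRoots F (2 ^ n + 1)) = 2 ^ n + 1 := by
    refine card_unityRoots (by omega) hα ⟨2 ^ n - 1, ?_⟩
    rw [← Nat.sq_sub_sq, mul_comm, pow_mul, one_pow]
  have hcU : (#(fixedUnits F n) : ℤ) = 2 ^ n - 1 := by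
    rw [fixedUnits, cast_card_erase_of_mem zero_mem_fixedSet, hK]
    push_cast
    rfl
  let g : F → ℤ := fun x =>
    sgnF (trF (2 * n) x + trF n ((α ^ (2 ^ n + 1)) ^ (d * τ) * (x ^ (2 ^ n + 1)) ^ d))
  have hg : crossCorr (2 * n) n d α τ = ∑ x ∈ univ.erase 0, g x := by
    rw [← sum_range_pow_primitiveRoot (by omega) (by omega) hα, crossCorr]
    refine sum_congr rfl fun t _ => ?_
    simp only [g]
    congr 3
    ring
  have hA' := mem_fixedUnits.1 hA
  have hgzv : ∀ z ∈ fixedUnits F n, ∀ v ∈ unityRoots F (2 ^ n + 1), g (z ^ (2 ^ l + 1) * v)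
      = trSign n (z * A) * trSign n (z ^ (2 ^ l + 1) * (v + v⁻¹)) := by
    intro z hz v hv
    have hz' := mem_fixedUnits.1 hz
    have e1 : z ^ (2 ^ l + 1) * v + (z ^ (2 ^ l + 1) * v) ^ 2 ^ n
        = z ^ (2 ^ l + 1) * (v + v⁻¹) := by
      rw [mul_pow, pow_two_pow_fixed hz'.2, pow_eq_inv_of_mem_unityRoots hv, mul_add]
    have e2 : (α ^ (2 ^ n + 1)) ^ (d * τ) * ((z ^ (2 ^ l + 1) * v) ^ (2 ^ n + 1)) ^ d
        = (z * A) ^ 2 ^ (i + 1) := by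
      rw [mul_pow _ v, mem_unityRoots.1 hv, mul_one, ← hAτ, mul_pow z, mul_comm]
      congr 1
      calc ((z ^ (2 ^ l + 1)) ^ (2 ^ n + 1)) ^ d = (z ^ (d * (2 ^ l + 1))) ^ 2 := by
            rw [pow_succ (z ^ (2 ^ l + 1)), pow_two_pow_fixed hz'.2]
            ring
        _ = z ^ 2 ^ (i + 1) := by
            rw [pow_eq_pow_of_modEq_of_fixed hz'.1 hz'.2 hdi, ← pow_mul, ← pow_succ]
    have hzA := (mem_fixedUnits.1 (mul_mem_fixedUnits hz hA)).2
    simp only [g]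
    rw [trF_two_mul, e1, e2, trF_pow_two_pow hzA, ← trF_add, mul_comm (trSign n (z * A))]
    exact trSign_add (fixed_mul (pow_two_pow_fixed hz'.2 _)
      (mem_fixedSet.1 (add_inv_mem_fixedSet_of_mem_unityRoots hv))) hzA
  rw [hg, sum_polar hK hU hF hdi]
  have hinner : ∀ z ∈ fixedUnits F n, ∑ v ∈ unityRoots F (2 ^ n + 1), g (z ^ (2 ^ l + 1) * v)
      = -∑ x ∈ fixedUnits F n, trSign n (z * (x ^ 2 ^ l + x⁻¹ + A)) := by
    intro z hz
    rw [sum_congr rfl (hgzv z hz), ← mul_sum,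
      sum_unitCircle_trSign hn hK hU (pow_mem_fixedUnits hz _), sum_trSign_add_inv_eq hz, mul_neg,
      mul_sum]
    congr 1
    refine sum_congr rfl fun x hx => ?_
    rw [mul_add _ _ A, mul_comm, trSign_add _ (mem_fixedUnits.1 (mul_mem_fixedUnits hz hA)).2]
    exact fixed_mul (mem_fixedUnits.1 hz).2 (fixed_add
      (mem_fixedUnits.1 (pow_mem_fixedUnits hx _)).2 (mem_fixedUnits.1 (inv_mem_fixedUnits hx)).2)
  rw [sum_congr rfl hinner, sum_neg_distrib, sum_comm]
  have hcol : ∀ x ∈ fixedUnits F n, ∑ z ∈ fixedUnits F n, trSign n (z * (x ^ 2 ^ l + x⁻¹ + A))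
      = (if x ^ 2 ^ l + x⁻¹ = A then 2 ^ n else 0) - 1 := by
    intro x hx
    rw [sum_units_trSign_mul hn hK (fixed_add (fixed_add
      (mem_fixedUnits.1 (pow_mem_fixedUnits hx _)).2
      (mem_fixedUnits.1 (inv_mem_fixedUnits hx)).2) hA'.2)]
    simp only [CharTwo.add_eq_zero]
    split_ifs <;> ring
  rw [sum_congr rfl hcol, sum_sub_distrib, ← sum_filter, sum_const, sum_const, nsmul_eq_mul,
    nsmul_eq_mul, hcU]
  ring

end Correlation

section RootCount

variable {F : Type*} [Field F]

theorem add_inv_translate_iff [CharP F 2] {l : ℕ} {x w : F} (hx : x ≠ 0) (hw : w ≠ 0) (hxw : w⁻¹ + x ≠ 0) :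
    (w⁻¹ + x) ^ 2 ^ l + (w⁻¹ + x)⁻¹ = x ^ 2 ^ l + x⁻¹ ↔ w ^ 2 ^ l + x ^ 2 * w = x := by
  have h1 : w⁻¹ + x = (1 + x * w) * w⁻¹ := by field_simp
  have h2 : 1 + x * w ≠ 0 := fun h => hxw (by rw [h1, h, zero_mul])
  have h3 : (2 : F) = 0 := CharTwo.two_eq_zero
  rw [add_pow_char_pow, inv_pow, h1, mul_inv, inv_inv]
  have hwl : w ^ 2 ^ l ≠ 0 := pow_ne_zero _ hw
  generalize w ^ 2 ^ l = W at *
  generalize x ^ 2 ^ l = X at *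
  constructor
  · intro h
    field_simp at h
    linear_combination h + (W - x) * h3
  · intro h
    field_simp
    linear_combination h + (x - W) * h3

variable [Fintype F] [DecidableEq F]

theorem exists_pow_eq_of_mem_fixedUnits {n : ℕ} {a : ℕ}
    (ha : Set.InjOn (fun z : F => z ^ a) (fixedUnits F n)) {x : F} (hx : x ∈ fixedUnits F n) :
    ∃ y ∈ fixedUnits F n, y ^ a = x :=
  surjOn_of_injOn_of_card_le _ (fun _ hz => pow_mem_fixedUnits hz a) ha le_rfl hx

theorem one_mem_fixedUnits {n : ℕ} : (1 : F) ∈ fixedUnits F n := by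
  simp [mem_fixedUnits]

variable [CharP F 2]

theorem card_roots_eq_succ {n l : ℕ} {x : F} (hx : x ∈ fixedUnits F n) :
    #{y ∈ fixedUnits F n | y ^ 2 ^ l + y⁻¹ = x ^ 2 ^ l + x⁻¹}
      = #{w ∈ fixedSet F n | w ^ 2 ^ l + x ^ 2 * w = x} + 1 := by
  have hx' := mem_fixedUnits.1 hx
  rw [← card_erase_add_one (a := x) (by simp [hx])]
  congr 1
  have hxx : ∀ a : F, a + x + x = a := fun a => CharTwo.add_cancel_right a x
  refine card_nbij' (fun y => (y + x)⁻¹) (fun w => w⁻¹ + x) ?_ ?_ ?_ ?_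
  · intro y hy
    rw [mem_coe, mem_erase, mem_filter, mem_fixedUnits] at hy
    have hyx : y + x ≠ 0 := fun h => hy.1 (CharTwo.add_eq_zero.1 h)
    have hyx' : (y + x)⁻¹⁻¹ + x = y := by rw [inv_inv, hxx]
    rw [mem_coe, mem_filter, mem_fixedSet]
    refine ⟨fixed_inv (fixed_add hy.2.1.2 hx'.2), ?_⟩
    rw [← add_inv_translate_iff hx'.1 (inv_ne_zero hyx) (by rw [hyx']; exact hy.2.1.1), hyx']
    exact hy.2.2
  · intro w hw
    rw [mem_coe, mem_filter, mem_fixedSet] at hw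
    have hw0 : w ≠ 0 := by
      rintro rfl
      simp [hx'.1.symm] at hw
    have hwx : w⁻¹ + x ≠ 0 := fun h => by
      have h1 : x = w⁻¹ := (CharTwo.add_eq_zero.1 h).symm
      have h2 := hw.2
      rw [sq, mul_assoc, h1, inv_mul_cancel₀ hw0, mul_one, add_eq_right] at h2
      exact pow_ne_zero _ hw0 h2
    rw [mem_coe, mem_erase, mem_filter, mem_fixedUnits]
    exact ⟨by simpa using hw0, ⟨hwx, fixed_add (fixed_inv hw.1) hx'.2⟩,
      (add_inv_translate_iff hx'.1 hw0 hwx).2 hw.2⟩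
  · intro y _
    simp only [inv_inv, hxx]
  · intro w _
    simp only [inv_inv, hxx]

theorem card_affine_roots {n l : ℕ} {b c w : F} (hw : w ∈ fixedSet F n)
    (hwc : w ^ 2 ^ l + b * w = c) :
    #{v ∈ fixedSet F n | v ^ 2 ^ l + b * v = c} = #{v ∈ fixedSet F n | v ^ 2 ^ l + b * v = 0} := by
  have hw' := mem_fixedSet.1 hw
  have key : ∀ v : F, (v + w) ^ 2 ^ l + b * (v + w) = v ^ 2 ^ l + b * v + c := fun v => by
    rw [add_pow_char_pow, ← hwc]
    ring
  refine card_nbij' (· + w) (· + w) ?_ ?_ ?_ ?_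
  · intro v hv
    simp only [coe_filter, Set.mem_ofPred_eq, mem_fixedSet] at hv ⊢
    exact ⟨fixed_add hv.1 hw', by rw [key, hv.2, CharTwo.add_self_eq_zero]⟩
  · intro v hv
    simp only [coe_filter, Set.mem_ofPred_eq, mem_fixedSet] at hv ⊢
    exact ⟨fixed_add hv.1 hw', by rw [key, hv.2, zero_add]⟩
  · exact fun v _ => CharTwo.add_cancel_right v w
  · exact fun v _ => CharTwo.add_cancel_right v w

theorem filter_pow_add_self_eq_zero {n l k : ℕ} (hk : Nat.gcd n l = k) :
    {v ∈ fixedSet F n | v ^ 2 ^ l + v = 0} = fixedSet F k := by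
  ext v
  rw [mem_filter, mem_fixedSet, mem_fixedSet, CharTwo.add_eq_zero, ← hk]
  exact ⟨fun h => fixed_gcd h.1 h.2, fun h =>
    ⟨fixed_of_dvd (Nat.gcd_dvd_left _ _) h, fixed_of_dvd (Nat.gcd_dvd_right _ _) h⟩⟩

theorem card_pow_add_self_eq {n l k : ℕ} (hk : Nat.gcd n l = k) (hKk : #(fixedSet F k) = 2 ^ k)
    {c w : F} (hw : w ∈ fixedSet F n) (hwc : w ^ 2 ^ l + w = c) :
    #{v ∈ fixedSet F n | v ^ 2 ^ l + v = c} = 2 ^ k := by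
  have h := card_affine_roots (b := 1) (c := c) hw (by rwa [one_mul])
  simp only [one_mul] at h
  rw [h, filter_pow_add_self_eq_zero hk, hKk]

theorem card_affine_roots_of_eq_pow {n l : ℕ} {h : F} (hh : h ∈ fixedUnits F n) :
    #{w ∈ fixedSet F n | w ^ 2 ^ l + (h ^ 2 ^ l * h⁻¹) ^ 2 * w = h ^ 2 ^ l * h⁻¹}
      = #{v ∈ fixedSet F n | v ^ 2 ^ l + v = (h ^ (2 ^ l + 1))⁻¹} := by
  have hh' := mem_fixedUnits.1 hh
  have h0 := hh'.1
  have hf : (h ^ 2) ^ 2 ^ n = h ^ 2 := pow_two_pow_fixed hh'.2 2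
  have key : ∀ v : F, (h ^ 2 * v) ^ 2 ^ l + (h ^ 2 ^ l * h⁻¹) ^ 2 * (h ^ 2 * v) = h ^ 2 ^ l * h⁻¹
      ↔ v ^ 2 ^ l + v = (h ^ (2 ^ l + 1))⁻¹ := fun v => by
    have hl : h ^ 2 ^ l ≠ 0 := pow_ne_zero _ h0
    rw [mul_pow, pow_right_comm, pow_succ h (2 ^ l)]
    generalize h ^ 2 ^ l = H at *
    have e1 : H ^ 2 * v ^ 2 ^ l + (H * h⁻¹) ^ 2 * (h ^ 2 * v) = H ^ 2 * (v ^ 2 ^ l + v) := by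
      field_simp
    have e2 : H ^ 2 * (H * h)⁻¹ = H * h⁻¹ := by field_simp
    rw [e1, ← e2, mul_right_inj' (pow_ne_zero 2 hl)]
  refine card_nbij' ((h ^ 2)⁻¹ * ·) (h ^ 2 * ·) ?_ ?_ ?_ ?_
  · intro w hw
    simp only [coe_filter, Set.mem_ofPred_eq, mem_fixedSet] at hw ⊢
    refine ⟨fixed_mul (fixed_inv hf) hw.1, ?_⟩
    rw [← key, mul_inv_cancel_left₀ (pow_ne_zero 2 h0)]
    exact hw.2
  · intro v hv
    simp only [coe_filter, Set.mem_ofPred_eq, mem_fixedSet] at hv ⊢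
    exact ⟨fixed_mul hf hv.1, (key v).2 hv.2⟩
  · exact fun w _ => mul_inv_cancel_left₀ (pow_ne_zero 2 h0) w
  · exact fun w _ => inv_mul_cancel_left₀ (pow_ne_zero 2 h0) w

/-- If `x` is not a `(2 ^ l - 1)`-th power then `w ↦ w ^ 2 ^ l + x ^ 2 * w` is bijective. -/
theorem card_affine_roots_of_not_pow {n l : ℕ} {x c : F} (hx : x ∈ fixedUnits F n)
    (hc : c ∈ fixedSet F n) (hnot : ∀ h ∈ fixedUnits F n, h ^ 2 ^ l * h⁻¹ ≠ x) :
    #{w ∈ fixedSet F n | w ^ 2 ^ l + x ^ 2 * w = c} = 1 := by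
  have hker : ∀ g ∈ fixedSet F n, g ^ 2 ^ l + x ^ 2 * g = 0 → g = 0 := by
    intro g hg hgx
    by_contra hg0
    obtain ⟨h, hh, rfl⟩ := exists_pow_eq_of_mem_fixedUnits (a := 2 ^ 1)
      (fun y _ z _ hyz => pow_two_pow_inj 1 hyz) (mem_fixedUnits.2 ⟨hg0, mem_fixedSet.1 hg⟩)
    refine hnot h hh (pow_two_pow_inj 1 ?_)
    rw [mul_pow, pow_right_comm, CharTwo.add_eq_zero.1 hgx, pow_one, mul_assoc, ← mul_pow,
      mul_inv_cancel₀ (mem_fixedUnits.1 hh).1, one_pow, mul_one]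
  have hmaps : ∀ w ∈ fixedSet F n, w ^ 2 ^ l + x ^ 2 * w ∈ fixedSet F n := fun w hw => by
    rw [mem_fixedSet] at *
    exact fixed_add (pow_two_pow_fixed hw _)
      (fixed_mul (pow_two_pow_fixed (mem_fixedUnits.1 hx).2 2) hw)
  have hinj : Set.InjOn (fun w => w ^ 2 ^ l + x ^ 2 * w) (fixedSet F n) := by
    intro v hv w hw hvw
    refine CharTwo.add_eq_zero.1 (hker _ (mem_fixedSet.2
      (fixed_add (mem_fixedSet.1 hv) (mem_fixedSet.1 hw))) ?_)
    rw [← CharTwo.add_eq_zero] at hvw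
    rw [add_pow_char_pow, ← hvw]
    ring
  obtain ⟨w, hw, hwc⟩ := surjOn_of_injOn_of_card_le _ hmaps hinj le_rfl hc
  rw [card_eq_one]
  refine ⟨w, ?_⟩
  ext v
  rw [mem_filter, mem_singleton]
  constructor
  · rintro ⟨hv, hvc⟩
    exact hinj hv hw (hvc.trans hwc.symm)
  · rintro rfl
    exact ⟨hw, hwc⟩

/-- The possible numbers of roots of `x ^ (2 ^ l + 1) + A * x + 1` in the subfield of order
`2 ^ n`. -/
theorem card_roots_mem {n l k : ℕ} (hk : Nat.gcd n l = k) (hKk : #(fixedSet F k) = 2 ^ k) (A : F) :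
    #{x ∈ fixedUnits F n | x ^ 2 ^ l + x⁻¹ = A} = 0 ∨
    #{x ∈ fixedUnits F n | x ^ 2 ^ l + x⁻¹ = A} = 1 ∨
    #{x ∈ fixedUnits F n | x ^ 2 ^ l + x⁻¹ = A} = 2 ^ k + 1 ∨
    (#{x ∈ fixedUnits F n | x ^ 2 ^ l + x⁻¹ = A} = 2 ∧
      ∃ x ∈ fixedUnits F n, ∀ h ∈ fixedUnits F n, h ^ 2 ^ l * h⁻¹ ≠ x) := by
  rcases eq_empty_or_nonempty {x ∈ fixedUnits F n | x ^ 2 ^ l + x⁻¹ = A} with h | ⟨x, hxA⟩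
  · exact Or.inl (by rw [h, card_empty])
  · obtain ⟨hx, rfl⟩ := mem_filter.1 hxA
    rw [card_roots_eq_succ hx]
    by_cases hpow : ∃ h ∈ fixedUnits F n, h ^ 2 ^ l * h⁻¹ = x
    · obtain ⟨h, hh, rfl⟩ := hpow
      rw [card_affine_roots_of_eq_pow hh]
      rcases eq_empty_or_nonempty {v ∈ fixedSet F n | v ^ 2 ^ l + v = (h ^ (2 ^ l + 1))⁻¹}
        with hv | ⟨v, hv⟩
      · simp [hv]
      · rw [mem_filter] at hv
        rw [card_pow_add_self_eq hk hKk hv.1 hv.2]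
        simp
    · push Not at hpow
      rw [card_affine_roots_of_not_pow hx (mem_fixedSet.2 (mem_fixedUnits.1 hx).2) hpow]
      exact Or.inr (Or.inr (Or.inr ⟨rfl, x, hx, hpow⟩))

theorem exists_card_roots_eq_zero {n l : ℕ} :
    ∃ A ∈ fixedUnits F n, #{x ∈ fixedUnits F n | x ^ 2 ^ l + x⁻¹ = A} = 0 := by
  have hlt : #((fixedUnits F n).image fun x => x ^ 2 ^ l + x⁻¹) < #(fixedSet F n) :=
    card_image_le.trans_lt (card_erase_lt_of_mem zero_mem_fixedSet)
  obtain ⟨A, hA, hA'⟩ := exists_mem_notMem_of_card_lt_card hlt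
  refine ⟨A, mem_erase.2 ⟨?_, hA⟩, ?_⟩
  · rintro rfl
    exact hA' (mem_image.2 ⟨1, one_mem_fixedUnits, by
      rw [one_pow, inv_one, CharTwo.add_self_eq_zero]⟩)
  · rw [card_eq_zero, filter_eq_empty_iff]
    exact fun x hx hxA => hA' (mem_image.2 ⟨x, hx, hxA⟩)

theorem add_inv_mem_fixedUnits {n l d i : ℕ} (hdi : d * (2 ^ l + 1) ≡ 2 ^ i [MOD 2 ^ n - 1]) {x : F}
    (hx : x ∈ fixedUnits F n) (hx1 : x ≠ 1) : x ^ 2 ^ l + x⁻¹ ∈ fixedUnits F n := by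
  have hx' := mem_fixedUnits.1 hx
  refine mem_fixedUnits.2 ⟨fun h => hx1 ?_, fixed_add (pow_two_pow_fixed hx'.2 _) (fixed_inv hx'.2)⟩
  refine pow_two_pow_add_one_injOn hdi hx one_mem_fixedUnits ?_
  simp only
  rw [one_pow, pow_succ, CharTwo.add_eq_zero.1 h, inv_mul_cancel₀ hx'.1]

theorem exists_card_roots_eq_two {n l k d i : ℕ} (hk : Nat.gcd n l = k)
    (hdi : d * (2 ^ l + 1) ≡ 2 ^ i [MOD 2 ^ n - 1]) (hKk : #(fixedSet F k) = 2 ^ k) (hk2 : 2 ≤ k) :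
    ∃ A ∈ fixedUnits F n, #{x ∈ fixedUnits F n | x ^ 2 ^ l + x⁻¹ = A} = 2 := by
  obtain ⟨x, hx, hnot⟩ : ∃ x ∈ fixedUnits F n, ∀ h ∈ fixedUnits F n, h ^ 2 ^ l * h⁻¹ ≠ x := by
    by_contra! hcon
    have hinj : Set.InjOn (fun h : F => h ^ 2 ^ l * h⁻¹) (fixedUnits F n) :=
      injOn_of_surjOn_of_card_le _ (fun h hh =>
        mul_mem_fixedUnits (pow_mem_fixedUnits hh _) (inv_mem_fixedUnits hh)) hcon le_rfl
    obtain ⟨g, hg, hg'⟩ := exists_mem_notMem_of_card_lt_card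
      (s := {0, 1}) (t := fixedSet F k) (card_le_two.trans_lt (by
        rw [hKk]; calc 2 < 2 ^ 2 := by norm_num
          _ ≤ 2 ^ k := Nat.pow_le_pow_right (by norm_num) hk2))
    rw [← filter_pow_add_self_eq_zero hk, mem_filter, mem_fixedSet, CharTwo.add_eq_zero] at hg
    simp only [mem_insert, mem_singleton, not_or] at hg'
    refine hg'.2 (hinj (mem_fixedUnits.2 ⟨hg'.1, hg.1⟩) one_mem_fixedUnits ?_)
    simp only
    rw [hg.2, mul_inv_cancel₀ hg'.1, one_pow, inv_one, mul_one]
  refine ⟨x ^ 2 ^ l + x⁻¹, add_inv_mem_fixedUnits hdi hx ?_, ?_⟩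
  · rintro rfl
    exact hnot 1 one_mem_fixedUnits (by simp)
  · rw [card_roots_eq_succ hx,
      card_affine_roots_of_not_pow hx (mem_fixedSet.2 (mem_fixedUnits.1 hx).2) hnot]

theorem exists_card_roots_eq_pow_add_one {n l k d i : ℕ} (hk : Nat.gcd n l = k)
    (hdi : d * (2 ^ l + 1) ≡ 2 ^ i [MOD 2 ^ n - 1]) (hKk : #(fixedSet F k) = 2 ^ k)
    (hlt : #(fixedSet F k) < #(fixedSet F n)) :
    ∃ A ∈ fixedUnits F n, #{x ∈ fixedUnits F n | x ^ 2 ^ l + x⁻¹ = A} = 2 ^ k + 1 := by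
  obtain ⟨v, hv, hv'⟩ := exists_mem_notMem_of_card_lt_card hlt
  rw [← filter_pow_add_self_eq_zero hk, mem_filter, not_and] at hv'
  have hc : v ^ 2 ^ l + v ∈ fixedUnits F n := mem_fixedUnits.2 ⟨hv' hv,
    fixed_add (pow_two_pow_fixed (mem_fixedSet.1 hv) _) (mem_fixedSet.1 hv)⟩
  obtain ⟨h, hh, hhc⟩ := exists_pow_eq_of_mem_fixedUnits (pow_two_pow_add_one_injOn hdi)
    (inv_mem_fixedUnits hc)
  have hx := mul_mem_fixedUnits (pow_mem_fixedUnits hh (2 ^ l)) (inv_mem_fixedUnits hh)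
  have hcard : #{y ∈ fixedUnits F n | y ^ 2 ^ l + y⁻¹
      = (h ^ 2 ^ l * h⁻¹) ^ 2 ^ l + (h ^ 2 ^ l * h⁻¹)⁻¹} = 2 ^ k + 1 := by
    rw [card_roots_eq_succ hx, card_affine_roots_of_eq_pow hh, hhc, inv_inv,
      card_pow_add_self_eq hk hKk hv rfl]
  refine ⟨_, add_inv_mem_fixedUnits hdi hx fun h1 => ?_, hcard⟩
  have hle : #{y ∈ fixedUnits F n | y ^ 2 ^ l + y⁻¹
      = (h ^ 2 ^ l * h⁻¹) ^ 2 ^ l + (h ^ 2 ^ l * h⁻¹)⁻¹} ≤ 1 := by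
    rw [card_le_one_iff_subset_singleton]
    refine ⟨1, fun y hy => mem_singleton.2 ?_⟩
    obtain ⟨hy, hy0⟩ := mem_filter.1 hy
    by_contra hy1
    refine (mem_fixedUnits.1 (add_inv_mem_fixedUnits hdi hy hy1)).1 ?_
    rw [hy0, h1, one_pow, inv_one, CharTwo.add_self_eq_zero]
  have := Nat.two_pow_pos k
  omega

theorem exists_card_roots_eq_one {n l k d i : ℕ} (hk : Nat.gcd n l = k)
    (hdi : d * (2 ^ l + 1) ≡ 2 ^ i [MOD 2 ^ n - 1]) (hlt : 2 * #(fixedSet F k) ≤ #(fixedSet F n)) :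
    ∃ A ∈ fixedUnits F n, #{x ∈ fixedUnits F n | x ^ 2 ^ l + x⁻¹ = A} = 1 := by
  have himage : 2 * #((fixedSet F n).image fun v => v ^ 2 ^ l + v) ≤ #(fixedSet F n) := by
    refine mul_card_image_le_card _ _ fun c hc => ?_
    obtain ⟨v, hv, rfl⟩ := mem_image.1 hc
    have hv1 : v ≠ v + 1 := fun h => one_ne_zero (left_eq_add.1 h)
    refine (card_pair hv1).ge.trans (card_le_card fun w hw => ?_)
    rw [mem_insert, mem_singleton] at hw
    rw [mem_filter]
    rcases hw with rfl | rfl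
    · exact ⟨hv, rfl⟩
    · refine ⟨mem_fixedSet.2 (fixed_add (mem_fixedSet.1 hv) (one_pow _)), ?_⟩
      rw [add_pow_char_pow, one_pow, add_add_add_comm, CharTwo.add_self_eq_zero, add_zero]
  have hpos : 0 < #(fixedSet F k) := card_pos.2 ⟨0, zero_mem_fixedSet⟩
  have hbad : #(((fixedSet F n).image fun v => v ^ 2 ^ l + v) ∪
      (fixedUnits F k).image fun h => (h ^ (2 ^ l + 1))⁻¹) < #(fixedSet F n) := by
    refine (card_union_le _ _).trans_lt ?_
    have h1 : #((fixedUnits F k).image fun h => (h ^ (2 ^ l + 1))⁻¹) < #(fixedSet F k) :=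
      card_image_le.trans_lt (card_erase_lt_of_mem zero_mem_fixedSet)
    omega
  obtain ⟨c, hc, hc'⟩ := exists_mem_notMem_of_card_lt_card hbad
  rw [mem_union, not_or, mem_image, mem_image] at hc'
  push Not at hc'
  have hc0 : c ≠ 0 := by
    rintro rfl
    exact hc'.1 0 zero_mem_fixedSet (by simp)
  obtain ⟨h, hh, hhc⟩ := exists_pow_eq_of_mem_fixedUnits (pow_two_pow_add_one_injOn hdi)
    (inv_mem_fixedUnits (mem_fixedUnits.2 ⟨hc0, mem_fixedSet.1 hc⟩))
  have hh' := mem_fixedUnits.1 hh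
  have hx := mul_mem_fixedUnits (pow_mem_fixedUnits hh (2 ^ l)) (inv_mem_fixedUnits hh)
  refine ⟨_, add_inv_mem_fixedUnits hdi hx fun h1 => ?_, ?_⟩
  · have hl : h ^ 2 ^ l = h := by rw [← mul_inv_eq_one₀ hh'.1]; exact h1
    refine hc'.2 h (mem_fixedUnits.2 ⟨hh'.1, ?_⟩) (by rw [hhc, inv_inv])
    rw [← hk]
    exact fixed_gcd hh'.2 hl
  · rw [card_roots_eq_succ hx, card_affine_roots_of_eq_pow hh, hhc, inv_inv, Nat.add_eq_right,
      card_eq_zero, filter_eq_empty_iff]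
    exact fun v hv => hc'.1 v hv

/-- If `gcd n l = 1`, every nonzero element of the subfield is a `(2 ^ l - 1)`-th power. -/
theorem exists_pow_mul_inv_eq {n l : ℕ} (hk : Nat.gcd n l = 1) {x : F} (hx : x ∈ fixedUnits F n) :
    ∃ h ∈ fixedUnits F n, h ^ 2 ^ l * h⁻¹ = x := by
  have hinj : Set.InjOn (fun h : F => h ^ 2 ^ l * h⁻¹) (fixedUnits F n) := by
    intro g hg h hh hgh
    rw [mem_coe, mem_fixedUnits] at hg hh
    have hg0 := hg.1
    have hh0 := hh.1
    have hl : (g * h⁻¹) ^ 2 ^ l = g * h⁻¹ := by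
      simp only at hgh
      rw [mul_pow, inv_pow]
      have := pow_ne_zero (2 ^ l) hh0
      field_simp at hgh ⊢
      linear_combination hgh
    have h2 := fixed_gcd (fixed_mul hg.2 (fixed_inv hh.2)) hl
    rw [hk, fixed_iff] at h2
    rcases h2 with h2 | h2
    · exact absurd h2 (mul_ne_zero hg0 (inv_ne_zero hh0))
    · rw [← mul_inv_eq_one₀ hh0]
      simpa using h2
  exact surjOn_of_injOn_of_card_le _ (fun h hh =>
    mul_mem_fixedUnits (pow_mem_fixedUnits hh _) (inv_mem_fixedUnits hh)) hinj le_rfl hx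

end RootCount

section ShiftParameter

variable {F : Type*} [Field F] [Fintype F] [DecidableEq F] [CharP F 2]

theorem exists_mem_fixedUnits_of_shift {n i : ℕ} (hF : Fintype.card F = 2 ^ (2 * n)) {α : F}
    (hα0 : α ≠ 0) (e : ℕ) :
    ∃ A ∈ fixedUnits F n, A ^ 2 ^ (i + 1) = (α ^ (2 ^ n + 1)) ^ e := by
  refine exists_pow_eq_of_mem_fixedUnits (fun y _ z _ hyz => pow_two_pow_inj (i + 1) hyz)
    (mem_fixedUnits.2 ⟨pow_ne_zero _ (pow_ne_zero _ hα0), pow_two_pow_fixed ?_ e⟩)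
  have h := FiniteField.pow_card α
  rw [hF, two_mul, pow_add] at h
  rw [← pow_mul, add_mul, pow_add, h, one_mul, mul_comm, ← pow_succ]

theorem exists_shift_of_mem_fixedUnits {n l d i : ℕ} (hn : n ≠ 0)
    (hdi : d * (2 ^ l + 1) ≡ 2 ^ i [MOD 2 ^ n - 1]) {α : F}
    (hα : IsPrimitiveRoot α (2 ^ (2 * n) - 1)) {A : F} (hA : A ∈ fixedUnits F n) :
    ∃ τ ≤ 2 ^ n - 2, A ^ 2 ^ (i + 1) = (α ^ (2 ^ n + 1)) ^ (d * τ) := by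
  obtain ⟨x, hx, hxA⟩ := exists_pow_eq_of_mem_fixedUnits (pow_injOn_of_modEq hdi)
    (pow_mem_fixedUnits hA (2 ^ (i + 1)))
  have h1 : 1 < 2 ^ n := Nat.one_lt_two_pow hn
  have hβ : IsPrimitiveRoot (α ^ (2 ^ n + 1)) (2 ^ n - 1) := by
    refine hα.pow ?_ ?_
    · have := Nat.one_lt_two_pow (n := 2 * n) (by omega)
      omega
    · rw [← Nat.sq_sub_sq, mul_comm, pow_mul, one_pow]
  have : NeZero (2 ^ n - 1) := ⟨by omega⟩
  have hx' := mem_fixedUnits.1 hx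
  obtain ⟨τ, hτ, rfl⟩ := hβ.eq_pow_of_pow_eq_one ((fixed_iff.1 hx'.2).resolve_left hx'.1)
  exact ⟨τ, by omega, by rw [← hxA, ← pow_mul, mul_comm d]⟩

end ShiftParameter

/-- With the standing notation (`n = kr`, `m = 2n`, `l = ks`, so
`k = gcd(l, n)`), let `d > 0` satisfy `d·(2^l+1) ≡ 2^i (mod 2^n−1)`.  If `k = 1` then
the set of values `{C_d(τ) : 0 ≤ τ ≤ 2^n−2}` is exactly the three-element set
`{−1, −1+2^n, −1−2^{n+1}}`; if `k ≥ 2` then it is exactly the four-element set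
`{−1, −1+2^n, −1−2^n, −1−2^{n+k}}`. -/
theorem crossCorr_three_or_four_valued
    (k r s n m l : ℕ) (hk : 1 ≤ k) (hr : 3 ≤ r) (hro : Odd r)
    (hn : n = k * r) (hm : m = 2 * n) (hl : l = k * s)
    (hse : Even s) (hs0 : 0 < s) (hsr : s < r) (hrs : Nat.gcd r s = 1)
    (F : Type) [Field F] [Fintype F] (hF : Fintype.card F = 2 ^ m)
    (α : F) (hα0 : α ≠ 0) (hα : ∀ x : F, x ≠ 0 → ∃ j : ℕ, α ^ j = x)
    (d i : ℕ) (hd : 0 < d)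
    (hdi : d * (2 ^ l + 1) ≡ 2 ^ i [MOD 2 ^ n - 1]) :
    (k = 1 →
      crossCorr m n d α '' {τ : ℕ | τ ≤ 2 ^ n - 2}
        = ({-1, -1 + 2 ^ n, -1 - 2 ^ (n + 1)} : Set ℤ)) ∧
    (2 ≤ k →
      crossCorr m n d α '' {τ : ℕ | τ ≤ 2 ^ n - 2}
        = ({-1, -1 + 2 ^ n, -1 - 2 ^ n, -1 - 2 ^ (n + k)} : Set ℤ)) := by
  classical
  have hk0 : k ≠ 0 := by omega
  have hkn : k < n := by rw [hn]; nlinarith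
  have hn0 : n ≠ 0 := by omega
  have hgcd : Nat.gcd n l = k := by rw [hn, hl, Nat.gcd_mul_left, hrs, mul_one]
  have hkm : k ∣ 2 * n := ⟨2 * r, by rw [hn]; ring⟩
  subst hm
  have : CharP F 2 := by
    refine CharTwo.of_one_ne_zero_of_two_eq_zero one_ne_zero ?_
    have h := FiniteField.cast_card_eq_zero F
    rw [hF] at h
    push_cast at h
    exact pow_eq_zero_iff (by omega) |>.1 h
  have hprim : IsPrimitiveRoot α (2 ^ (2 * n) - 1) := by
    refine isPrimitiveRoot_of_generates ?_ hα0 hα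
    rw [hF, Nat.sub_add_cancel Nat.one_le_two_pow]
  have hKk : #(fixedSet F k) = 2 ^ k := card_fixedSet (by omega) hk0 hkm hprim
  have hKn : #(fixedSet F n) = 2 ^ n :=
    card_fixedSet (by omega) hn0 (Dvd.intro_left 2 rfl) hprim
  have hpow : 2 * 2 ^ k ≤ 2 ^ n := by
    rw [← pow_succ']
    exact Nat.pow_le_pow_right two_pos hkn
  have hlt : #(fixedSet F k) < #(fixedSet F n) := by
    have := Nat.two_pow_pos k
    omega
  have himage : crossCorr (2 * n) n d α '' {τ : ℕ | τ ≤ 2 ^ n - 2}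
      = (fun A : F => -1 + 2 ^ n * (1 - (#{x ∈ fixedUnits F n | x ^ 2 ^ l + x⁻¹ = A} : ℤ))) ''
        (fixedUnits F n) := by
    ext c
    constructor
    · rintro ⟨τ, -, rfl⟩
      obtain ⟨A, hA, hAτ⟩ := exists_mem_fixedUnits_of_shift (i := i) hF hα0 (d * τ)
      exact ⟨A, hA, (crossCorr_eq hn0 hF hdi hprim hA hAτ).symm⟩
    · rintro ⟨A, hA, rfl⟩
      obtain ⟨τ, hτ, hAτ⟩ := exists_shift_of_mem_fixedUnits hn0 hdi hprim hA
      exact ⟨τ, hτ, crossCorr_eq hn0 hF hdi hprim hA hAτ⟩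
  obtain ⟨A₀, hA₀, h₀⟩ := exists_card_roots_eq_zero (F := F) (n := n) (l := l)
  obtain ⟨A₁, hA₁, h₁⟩ := exists_card_roots_eq_one (F := F) hgcd hdi (by rw [hKk, hKn]; exact hpow)
  obtain ⟨A₃, hA₃, h₃⟩ := exists_card_roots_eq_pow_add_one hgcd hdi hKk hlt
  rw [himage]
  constructor
  · rintro rfl
    refine Set.Subset.antisymm ?_ ?_
    · rintro _ ⟨A, -, rfl⟩
      rcases card_roots_mem hgcd hKk A with h | h | h | ⟨-, x, hx, hnot⟩
      · right; left; simp [h]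
      · left; simp [h]
      · right; right; simp [h]; ring
      · obtain ⟨g, hg, hgx⟩ := exists_pow_mul_inv_eq hgcd hx
        exact absurd hgx (hnot g hg)
    · rintro _ (rfl | rfl | rfl)
      · exact ⟨A₁, hA₁, by simp [h₁]⟩
      · exact ⟨A₀, hA₀, by simp [h₀]⟩
      · exact ⟨A₃, hA₃, by simp [h₃]; ring⟩
  · intro hk2
    obtain ⟨A₂, hA₂, h₂⟩ := exists_card_roots_eq_two hgcd hdi hKk hk2
    refine Set.Subset.antisymm ?_ ?_
    · rintro _ ⟨A, -, rfl⟩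
      rcases card_roots_mem hgcd hKk A with h | h | h | ⟨h, -⟩
      · right; left; simp [h]
      · left; simp [h]
      · right; right; right; simp [h]; ring
      · right; right; left; simp [h]; ring
    · rintro _ (rfl | rfl | rfl | rfl)
      · exact ⟨A₁, hA₁, by simp [h₁]⟩
      · exact ⟨A₀, hA₀, by simp [h₀]⟩
      · exact ⟨A₂, hA₂, by simp [h₂]; ring⟩
      · exact ⟨A₃, hA₃, by simp [h₃]; ring⟩
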